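/- arXiv:1308.0727 — 2 statements merged into one kernel-verified Lean document; each statement's English description precedes it below -/
import Mathlib

section
/- Let I be an ideal of R[x] with canonical sequence (f_0, …, f_{n-1}), set f_n = 1, and suppose i ∈ {0, …, n-1} is such that f̄_i ≠ 0 and f̄_i is not an associate of f̄_{i+1}. Let r ∈ R[x] be such that r̄ is an irreducible factor of f̄_i/f̄_{i+1}. Then an ideal J of R[x] contains I and has invariant sequence (f̄_0, …, f̄_{i-1}, f̄_i/r̄, f̄_{i+1}, …, f̄_{n-1}) (entries up to associates) if and only if J = I + ⟨π^i g⟩ for some g ∈ R[x] satisfying: (i) r̄·ḡ = f̄_i; (ii) π^{i+1} g ∈ I; (iii) π^i r g ∈ I. Moreover, if g and g' both satisfy (i)–(iii), then I + ⟨π^i g⟩ = I + ⟨π^i g'⟩ if and only if π^i(g − g') ∈ I. -/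
open Polynomial

/-- The reduction map `R[x] → (R/πR)[x]`. -/
noncomputable def redMod {R : Type*} [CommRing R] (π : R) :
    R[X] →+* (R ⧸ Ideal.span {π})[X] :=
  Polynomial.mapRingHom (Ideal.Quotient.mk (Ideal.span {π}))

/-- `(f 0, …, f (n-1))` is a canonical sequence of the ideal `I` of `R[x]`. -/
def IsCanonicalSequence {R : Type*} [CommRing R] (π : R) (n : ℕ)
    (I : Ideal R[X]) (f : ℕ → R[X]) : Prop :=
  ∀ i < n, (C π ^ i * f i ∈ I) ∧
    ∀ g : R[X], C π ^ i * g ∈ I →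
      redMod π g = 0 ∨ (redMod π (f i) ≠ 0 ∧ (redMod π (f i)).degree ≤ (redMod π g).degree)

section

variable {R : Type*} [CommRing R] {π : R}

theorem redMod_surjective : Function.Surjective (redMod π) :=
  Polynomial.map_surjective _ Ideal.Quotient.mk_surjective

@[simp]
theorem redMod_C_self : redMod π (C π) = 0 := by
  simp [redMod, Ideal.Quotient.eq_zero_iff_mem.mpr (Ideal.mem_span_singleton_self π)]

theorem exists_eq_add_C_mul {p q : R[X]} (h : redMod π p = redMod π q) :
    ∃ s, p = q + C π * s := by
  have hC : C π ∣ p - q := by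
    rw [C_dvd_iff_dvd_coeff]
    intro k
    have hk := congrArg (fun t => t.coeff k) h
    simp only [redMod, coe_mapRingHom, coeff_map] at hk
    rw [coeff_sub]
    exact Ideal.mem_span_singleton.mp (Ideal.Quotient.eq.mp hk)
  obtain ⟨s, hs⟩ := hC
  exact ⟨s, by rw [← hs]; ring⟩

/-- A canonical sequence consists, modulo `π`, of generators of the ideals
`{redMod π g | π ^ i * g ∈ I}`. -/
theorem isCanonicalSequence_iff_dvd [(Ideal.span {π}).IsMaximal] {n : ℕ} {I : Ideal R[X]}
    {f : ℕ → R[X]} :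
    IsCanonicalSequence π n I f ↔ ∀ i < n, C π ^ i * f i ∈ I ∧
      ∀ g : R[X], C π ^ i * g ∈ I → redMod π (f i) ∣ redMod π g := by
  let _ := Ideal.Quotient.field (Ideal.span {π})
  refine forall₂_congr fun i _ => and_congr_right fun hmem => ⟨fun h g hg => ?_, fun h g hg => ?_⟩
  · rcases h g hg with h0 | ⟨hf, -⟩
    · rw [h0]
      exact dvd_zero _
    obtain ⟨q, hq⟩ := redMod_surjective (redMod π g / redMod π (f i))
    have hmod : redMod π (g - f i * q) = redMod π g % redMod π (f i) := by
      rw [map_sub, map_mul, hq, sub_eq_iff_eq_add, EuclideanDomain.mod_add_div]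
    have hqI : C π ^ i * (g - f i * q) ∈ I := by
      convert I.sub_mem hg (I.mul_mem_right q hmem) using 1
      ring
    rw [← EuclideanDomain.mod_eq_zero, ← hmod]
    refine (h _ hqI).resolve_right fun hle => hle.2.not_gt ?_
    rw [hmod]
    exact EuclideanDomain.mod_lt _ hf
  · rw [or_iff_not_imp_left]
    exact fun h0 => ⟨ne_zero_of_dvd_ne_zero h0 (h g hg), degree_le_of_dvd (h g hg) h0⟩

/-- If `I ≤ J`, and for all `j ≥ m` the polynomials `p` with `π ^ j * p` in `J` have the same
reductions as those with `π ^ j * p` in `I`, then `I` and `J` have the same multiples of `π ^ m`. -/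
theorem mem_of_forall_exists_redMod_eq {n : ℕ} (hnil : π ^ n = 0) {I J : Ideal R[X]} (hIJ : I ≤ J)
    {m : ℕ} (H : ∀ j < n, m ≤ j → ∀ p, C π ^ j * p ∈ J →
      ∃ q, C π ^ j * q ∈ I ∧ redMod π p = redMod π q)
    {p : R[X]} (hp : C π ^ m * p ∈ J) : C π ^ m * p ∈ I := by
  by_cases hm : m < n
  · obtain ⟨q, hq, hpq⟩ := H m hm le_rfl p hp
    obtain ⟨s, rfl⟩ := exists_eq_add_C_mul hpq
    have hs : C π ^ (m + 1) * s ∈ J := by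
      convert J.sub_mem hp (hIJ hq) using 1
      ring
    have := mem_of_forall_exists_redMod_eq hnil hIJ
      (fun j hj hmj => H j hj (Nat.le_of_succ_le hmj)) hs
    convert I.add_mem hq this using 1
    rw [Nat.succ_eq_add_one]
    ring
  · rw [← C_pow, pow_eq_zero_of_le (not_lt.mp hm) hnil]
    simp
termination_by n - m

theorem C_pow_mul_mem_of_dvd [IsDomain (R ⧸ Ideal.span {π})] {I : Ideal R[X]} {i : ℕ}
    {f r g q : R[X]} (hf : redMod π f ≠ 0) (hrg : redMod π r * redMod π g = redMod π f)
    (hπ : C π ^ (i + 1) * g ∈ I) (hr : C π ^ i * (r * g) ∈ I)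
    (hdvd : redMod π f ∣ redMod π (g * q)) : C π ^ i * (g * q) ∈ I := by
  have hg : redMod π g ≠ 0 := by
    intro h
    simp [← hrg, h] at hf
  rw [← hrg, map_mul, mul_comm (redMod π r), mul_dvd_mul_iff_left hg] at hdvd
  obtain ⟨t, ht⟩ := hdvd
  obtain ⟨t, rfl⟩ := redMod_surjective t
  rw [← map_mul] at ht
  obtain ⟨s, rfl⟩ := exists_eq_add_C_mul ht
  convert I.add_mem (I.mul_mem_right t hr) (I.mul_mem_right s hπ) using 1
  ring

theorem exists_of_mem_sup_span {I : Ideal R[X]} {a x : R[X]} (h : x ∈ I ⊔ Ideal.span {a}) :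
    ∃ q, x - a * q ∈ I := by
  obtain ⟨y, hy, z, hz, rfl⟩ := Submodule.mem_sup.mp h
  obtain ⟨q, rfl⟩ := Ideal.mem_span_singleton.mp hz
  exact ⟨q, by simpa using hy⟩

end

/-- Theorem 4.5: description of the ideals containing `I` whose invariant sequence is
obtained from that of `I` by dividing the `i`-th entry by the irreducible factor `r̄`. -/
theorem ideals_above_with_divided_invariant {R : Type*} [CommRing R] [IsLocalRing R]
    (π : R) (n : ℕ) (hn : 1 ≤ n)
    (hmax : IsLocalRing.maximalIdeal R = Ideal.span {π})
    (hnil : π ^ n = 0) (hne : π ^ (n - 1) ≠ 0)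
    (I : Ideal R[X]) (f : ℕ → R[X])
    (hcan : IsCanonicalSequence π n I f) (hfn : f n = 1)
    (i : ℕ) (hi : i < n) (hfi : redMod π (f i) ≠ 0)
    (hne' : ¬ Associated (redMod π (f i)) (redMod π (f (i + 1))))
    (r : R[X]) (hr : Irreducible (redMod π r))
    (hdvd : redMod π r * redMod π (f (i + 1)) ∣ redMod π (f i)) :
    (∀ J : Ideal R[X],
      (I ≤ J ∧ ∃ h : ℕ → R[X], IsCanonicalSequence π n J h ∧
          (∀ j < n, j ≠ i → Associated (redMod π (h j)) (redMod π (f j))) ∧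
          Associated (redMod π r * redMod π (h i)) (redMod π (f i))) ↔
        (∃ g : R[X],
          redMod π r * redMod π g = redMod π (f i) ∧
          C π ^ (i + 1) * g ∈ I ∧
          C π ^ i * (r * g) ∈ I ∧
          J = I ⊔ Ideal.span {C π ^ i * g})) ∧
    (∀ g g' : R[X],
      (redMod π r * redMod π g = redMod π (f i) ∧
        C π ^ (i + 1) * g ∈ I ∧ C π ^ i * (r * g) ∈ I) →
      (redMod π r * redMod π g' = redMod π (f i) ∧
        C π ^ (i + 1) * g' ∈ I ∧ C π ^ i * (r * g') ∈ I) →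
      (I ⊔ Ideal.span {C π ^ i * g} = I ⊔ Ideal.span {C π ^ i * g'} ↔
        C π ^ i * (g - g') ∈ I)) := by
  have : (Ideal.span {π}).IsMaximal := hmax ▸ inferInstance
  have : IsDomain (R ⧸ Ideal.span {π}) := Ideal.Quotient.isDomain _
  rw [isCanonicalSequence_iff_dvd] at hcan
  obtain ⟨hfmem, hfdvd⟩ := hcan i hi
  refine ⟨fun J => ⟨?_, ?_⟩, ?_⟩
  · rintro ⟨hIJ, h, hh, hassoc, hri⟩
    rw [isCanonicalSequence_iff_dvd] at hh
    have hlift : ∀ j < n, j ≠ i → ∀ p, C π ^ j * p ∈ J →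
        ∃ q, C π ^ j * q ∈ I ∧ redMod π p = redMod π q := by
      intro j hj hji p hp
      obtain ⟨t, ht⟩ := (hassoc j hj hji).symm.dvd.trans ((hh j hj).2 p hp)
      obtain ⟨t, rfl⟩ := redMod_surjective t
      refine ⟨f j * t, ?_, by rw [ht, map_mul]⟩
      rw [← mul_assoc]
      exact I.mul_mem_right t (hcan j hj).1
    have habove : ∀ p, C π ^ (i + 1) * p ∈ J → C π ^ (i + 1) * p ∈ I := fun p =>
      mem_of_forall_exists_redMod_eq hnil hIJ fun j hj hij => hlift j hj (by omega)
    obtain ⟨u, hu⟩ := hri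
    obtain ⟨v, hv⟩ := redMod_surjective (u : (R ⧸ Ideal.span {π})[X])
    have hgJ : C π ^ i * (h i * v) ∈ J := by
      rw [← mul_assoc]
      exact J.mul_mem_right v (hh i hi).1
    have hrg : redMod π r * redMod π (h i * v) = redMod π (f i) := by
      rw [map_mul, hv, ← mul_assoc, hu]
    have hgdvd : redMod π (h i * v) ∣ redMod π (h i) := by
      rw [map_mul, hv, Units.mul_right_dvd]
    refine ⟨h i * v, hrg, habove _ ?_, ?_, le_antisymm ?_ ?_⟩
    · convert J.mul_mem_left (C π) hgJ using 1
      ring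
    · rw [← map_mul] at hrg
      obtain ⟨s, hs⟩ := exists_eq_add_C_mul hrg
      have hsJ : C π ^ (i + 1) * s ∈ J := by
        convert J.sub_mem (J.mul_mem_left r hgJ) (hIJ hfmem) using 1
        linear_combination (-C π ^ i) * hs
      rw [hs]
      convert I.add_mem hfmem (habove s hsJ) using 1
      ring
    · intro p hp
      have hle : I ⊔ Ideal.span {C π ^ i * (h i * v)} ≤ J :=
        sup_le hIJ ((Ideal.span_singleton_le_iff_mem _).mpr hgJ)
      have := mem_of_forall_exists_redMod_eq hnil hle (m := 0) (p := p) ?_ (by simpa using hp)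
      · simpa using this
      intro j hj _ p hp
      by_cases hji : j = i
      · subst hji
        obtain ⟨t, ht⟩ := hgdvd.trans ((hh j hj).2 p hp)
        obtain ⟨t, rfl⟩ := redMod_surjective t
        refine ⟨h j * v * t, ?_, by rw [ht, map_mul _ _ t]⟩
        rw [← mul_assoc (C π ^ j) (h j * v) t]
        exact Ideal.mul_mem_right t _
          (Ideal.mem_sup_right (Ideal.mem_span_singleton_self _))
      · obtain ⟨q, hq, hpq⟩ := hlift j hj hji p hp
        exact ⟨q, Ideal.mem_sup_left hq, hpq⟩
    · exact sup_le hIJ ((Ideal.span_singleton_le_iff_mem _).mpr hgJ)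
  · rintro ⟨g, hrg, hπ, hr', rfl⟩
    refine ⟨le_sup_left, Function.update f i g, ?_, fun j _ hji => by simp [hji], by simp [hrg]⟩
    rw [isCanonicalSequence_iff_dvd]
    intro j hj
    rcases lt_trichotomy j i with hji | rfl | hij
    · rw [Function.update_of_ne hji.ne]
      refine ⟨Ideal.mem_sup_left (hcan j hj).1, fun p hp => ?_⟩
      obtain ⟨q, hq⟩ := exists_of_mem_sup_span hp
      obtain ⟨k, rfl⟩ := Nat.exists_eq_add_of_lt hji
      have := (hcan j hj).2 (p - C π ^ (k + 1) * g * q) (by convert hq using 1; ring)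
      simpa using this
    · rw [Function.update_self]
      refine ⟨Ideal.mem_sup_right (Ideal.mem_span_singleton_self _), fun p hp => ?_⟩
      obtain ⟨q, hq⟩ := exists_of_mem_sup_span hp
      have := hfdvd (p - g * q) (by convert hq using 1; ring)
      rw [map_sub, map_mul] at this
      exact (dvd_sub_left (dvd_mul_right _ _)).mp ((Dvd.intro_left _ hrg).trans this)
    · rw [Function.update_of_ne hij.ne']
      refine ⟨Ideal.mem_sup_left (hcan j hj).1, fun p hp => (hcan j hj).2 p ?_⟩
      obtain ⟨q, hq⟩ := exists_of_mem_sup_span hp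
      obtain ⟨k, rfl⟩ := Nat.exists_eq_add_of_lt hij
      have := hfdvd (C π ^ (k + 1) * p - g * q) (by convert hq using 1; ring)
      have := C_pow_mul_mem_of_dvd hfi hrg hπ hr' (q := q) (by simpa using this)
      convert I.add_mem hq this using 1
      ring
  · rintro g g' ⟨hrg, hπ, hr'⟩ ⟨hrg', hπ', hr''⟩
    have hgg' : redMod π g = redMod π g' := mul_left_cancel₀ hr.ne_zero (hrg.trans hrg'.symm)
    constructor
    · intro heq
      have hg : C π ^ i * g ∈ I ⊔ Ideal.span {C π ^ i * g'} :=
        heq ▸ Ideal.mem_sup_right (Ideal.mem_span_singleton_self _)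
      obtain ⟨q, hq⟩ := exists_of_mem_sup_span hg
      have hdvd' := hfdvd (g - g' * q) (by convert hq using 1; ring)
      have := C_pow_mul_mem_of_dvd hfi hrg' hπ' hr'' (q := 1 - q) (by
        convert hdvd' using 1
        simp only [map_sub, map_mul, map_one, hgg']
        ring)
      convert I.sub_mem hq this using 1
      ring
    · intro hsub
      refine le_antisymm (sup_le le_sup_left ?_) (sup_le le_sup_left ?_) <;>
        rw [Ideal.span_singleton_le_iff_mem]
      · convert Ideal.add_mem _ (Ideal.mem_sup_left hsub)
          (Ideal.mem_sup_right (Ideal.mem_span_singleton_self (C π ^ i * g'))) using 1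
        ring
      · convert Ideal.sub_mem _ (Ideal.mem_sup_right (Ideal.mem_span_singleton_self (C π ^ i * g)))
          (Ideal.mem_sup_left hsub) using 1
        ring
end

section
/- Let A = (α_0, …, α_{n-1}) be a tuple of polynomials in F[x] with α_{n-1} ∣ α_{n-2} ∣ ⋯ ∣ α_0, and suppose that for some index i, α_j = 0 for all j < i and α_i ≠ 0; set α_n = 1. Choose a_j ∈ 𝔉[x] with ā_j = α_j/α_{j+1} for i ≤ j ≤ n-1. Let 𝓑 be the set of tuples (b_{jk}) indexed by i ≤ j ≤ n-2, 1 ≤ k ≤ n-j-1, with b_{jk} ∈ 𝔉[x] and either b_{jk} = 0 or deg b_{jk} < deg(α_{j+k}/α_{j+k+1}). For (b_{jk}) ∈ 𝓑 define recursively f_n = 1, f_j = a_j f_{j+1} + π b_{j1} f_{j+2} + ⋯ + π^{n-j-1} b_{j,n-j-1} f_n for i ≤ j ≤ n-1, and f_j = 0 for 0 ≤ j < i. Then the map sending (b_{jk}) to the ideal ⟨π^0 f_0, …, π^{n-1} f_{n-1}⟩ of R[x] is a bijection from 𝓑 onto the set of all ideals of R[x] whose invariant sequence equals (α_0, …, α_{n-1})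 up to associates entrywise. -/
open Polynomial

/-- All coefficients of the polynomial `p` lie in the set `𝔉`. -/
def CoeffsIn {R : Type*} [CommRing R] (𝔉 : Set R) (p : R[X]) : Prop :=
  ∀ m : ℕ, p.coeff m ∈ 𝔉

/-- The parameter set `𝓑`: `b j k ∈ 𝔉[x]` and `b j k = 0` or
`deg (b j k) < deg (α (j+k) / α (j+k+1))`, for `i ≤ j ≤ n-2`, `1 ≤ k ≤ n-j-1`. -/
def MemB {R : Type*} [CommRing R] (π : R) (𝔉 : Set R) (n i : ℕ)
    (α : ℕ → (R ⧸ Ideal.span {π})[X]) (b : ℕ → ℕ → R[X]) : Prop :=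
  ∀ j k : ℕ, i ≤ j → j + 2 ≤ n → 1 ≤ k → k + j + 1 ≤ n →
    CoeffsIn 𝔉 (b j k) ∧
      (b j k = 0 ∨ (b j k).degree + (α (j + k + 1)).degree < (α (j + k)).degree)

/-- The recursive construction (5.1) of the canonical sequence `f` from the data `a`, `b`. -/
def BuildEq {R : Type*} [CommRing R] (π : R) (n i : ℕ)
    (a : ℕ → R[X]) (b : ℕ → ℕ → R[X]) (f : ℕ → R[X]) : Prop :=
  f n = 1 ∧ (∀ j < i, f j = 0) ∧
    ∀ j : ℕ, i ≤ j → j < n →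
      f j = a j * f (j + 1) +
        ∑ k ∈ Finset.Icc 1 (n - j - 1), C π ^ k * b j k * f (j + k + 1)

/-- `φ` behaves like the reduction modulo `p`, where `p` is nilpotent of index `n` and
annihilators of the lower powers of `p` vanish modulo `p`. -/
structure IsChainReduction {A B : Type*} [CommRing A] [CommRing B] (p : A) (n : ℕ)
    (φ : A →+* B) : Prop where
  map_eq_zero_iff : ∀ g, φ g = 0 ↔ p ∣ g
  pow_eq_zero : p ^ n = 0
  map_eq_zero_of_pow_mul_eq_zero : ∀ m < n, ∀ g, p ^ m * g = 0 → φ g = 0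

/-- The ideal generated by `p ^ m * f m, …, p ^ (n - 1) * f (n - 1)`. -/
def tailIdeal {A : Type*} [CommRing A] (p : A) (n : ℕ) (f : ℕ → A) (m : ℕ) : Ideal A :=
  Ideal.span ((fun j => p ^ j * f j) '' Set.Ico m n)

section Tail

variable {A : Type*} [CommRing A] {p : A} {n : ℕ} {f : ℕ → A}

theorem pow_mul_mem_tailIdeal {m j : ℕ} (hp : p ^ n = 0) (hmj : m ≤ j) (hj : j ≤ n) :
    p ^ j * f j ∈ tailIdeal p n f m := by
  rcases hj.eq_or_lt with rfl | hj
  · simp [hp]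
  · exact Ideal.subset_span ⟨j, ⟨hmj, hj⟩, rfl⟩

theorem mem_tailIdeal_iff {m : ℕ} (hm : m < n) {x : A} :
    x ∈ tailIdeal p n f m ↔
      ∃ c, ∃ y ∈ tailIdeal p n f (m + 1), x = c * (p ^ m * f m) + y := by
  have : Set.Ico m n = insert m (Set.Ico (m + 1) n) := by
    ext l
    simp only [Set.mem_Ico, Set.mem_insert_iff]
    omega
  rw [tailIdeal, this, Set.image_insert_eq, Ideal.mem_span_insert]
  rfl

theorem pow_dvd_of_mem_tailIdeal {m : ℕ} {x : A} (hx : x ∈ tailIdeal p n f m) :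
    p ^ m ∣ x := by
  rw [← Ideal.mem_span_singleton]
  refine (Ideal.span_le.2 ?_ : tailIdeal p n f m ≤ _) hx
  rintro _ ⟨j, hj, rfl⟩
  exact Ideal.mem_span_singleton.2 ((pow_dvd_pow p hj.1).mul_right _)

/-- If `f j` is a combination of `p ^ k * f (j + k + 1)`, then `p ^ (j + 1) * f j` lies in
the next tail ideal. -/
theorem pow_succ_mul_mem_tailIdeal {j : ℕ} {a : A} {b : ℕ → A} (hp : p ^ n = 0) (hj : j < n)
    (h : f j = a * f (j + 1) +
      ∑ k ∈ Finset.Icc 1 (n - j - 1), p ^ k * b k * f (j + k + 1)) :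
    p ^ (j + 1) * f j ∈ tailIdeal p n f (j + 1) := by
  rw [h, mul_add, Finset.mul_sum]
  refine Ideal.add_mem _ ?_ (Ideal.sum_mem _ fun k hk => ?_)
  · rw [mul_left_comm]
    exact Ideal.mul_mem_left _ _ (pow_mul_mem_tailIdeal hp le_rfl hj)
  · rw [Finset.mem_Icc] at hk
    have : p ^ (j + 1) * (p ^ k * b k * f (j + k + 1)) =
        b k * (p ^ (j + k + 1) * f (j + k + 1)) := by ring
    rw [this]
    exact Ideal.mul_mem_left _ _ (pow_mul_mem_tailIdeal hp (by omega) (by omega))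

theorem pow_mul_sum_Icc (j : ℕ) (b : ℕ → A) :
    p ^ j * ∑ k ∈ Finset.Icc 1 (n - j - 1), p ^ k * b (j + k) * f (j + k + 1) =
      ∑ l ∈ Finset.Ico (j + 1) n, p ^ l * b l * f (l + 1) := by
  rw [Finset.mul_sum]
  refine Finset.sum_bij (fun k _ => j + k) ?_ ?_ ?_ ?_
  · intro k hk
    simp only [Finset.mem_Icc, Finset.mem_Ico] at *
    omega
  · intro k _ k' _ h
    omega
  · intro l hl
    simp only [Finset.mem_Ico] at hl
    exact ⟨l - j, by simp only [Finset.mem_Icc]; omega, by omega⟩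
  · intro k _
    ring

end Tail

namespace IsChainReduction

variable {A B : Type*} [CommRing A] [CommRing B] {p : A} {n : ℕ} {φ : A →+* B}

theorem map_self (h : IsChainReduction p n φ) : φ p = 0 :=
  (h.map_eq_zero_iff p).2 dvd_rfl

theorem map_eq_zero_of_pow_mul_eq (h : IsChainReduction p n φ) {m : ℕ} (hm : m < n) {g w : A}
    (hgw : p ^ m * g = p ^ (m + 1) * w) : φ g = 0 := by
  have := h.map_eq_zero_of_pow_mul_eq_zero m hm (g - p * w) (by rw [mul_sub, hgw]; ring)
  simpa [h.map_self] using this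

theorem map_eq_of_eq_add_sum (h : IsChainReduction p n φ) {a c : A} {s : Finset ℕ}
    (hs : ∀ k ∈ s, 1 ≤ k) {b d : ℕ → A} {x : A}
    (hx : x = a * c + ∑ k ∈ s, p ^ k * b k * d k) : φ x = φ a * φ c := by
  have : ∑ k ∈ s, φ (p ^ k * b k * d k) = 0 :=
    Finset.sum_eq_zero fun k hk => by
      have : k ≠ 0 := by have := hs k hk; omega
      simp [h.map_self, this]
  rw [hx, map_add, map_mul, map_sum, this, add_zero]

variable [IsDomain B]

theorem mem_tailIdeal_succ (h : IsChainReduction p n φ) {f : ℕ → A} {m : ℕ} (hm : m < n)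
    (hfm : f m = 0 ∨ φ (f m) ≠ 0) (hcl : p ^ (m + 1) * f m ∈ tailIdeal p n f (m + 1))
    {x : A} (hx : x ∈ tailIdeal p n f m) (hdvd : p ^ (m + 1) ∣ x) :
    x ∈ tailIdeal p n f (m + 1) := by
  obtain ⟨c, y, hy, rfl⟩ := (mem_tailIdeal_iff hm).1 hx
  refine Ideal.add_mem _ ?_ hy
  rcases hfm with h0 | h0
  · simp [h0]
  · obtain ⟨w, hw⟩ := hdvd
    obtain ⟨y', rfl⟩ := pow_dvd_of_mem_tailIdeal hy
    have h1 : φ (c * f m) = 0 :=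
      h.map_eq_zero_of_pow_mul_eq hm (w := w - y') (by linear_combination hw)
    rw [map_mul, mul_eq_zero, or_iff_left h0, h.map_eq_zero_iff] at h1
    obtain ⟨c', rfl⟩ := h1
    have : p * c' * (p ^ m * f m) = c' * (p ^ (m + 1) * f m) := by ring
    rw [this]
    exact Ideal.mul_mem_left _ _ hcl

theorem dvd_map_of_pow_mul_mem (h : IsChainReduction p n φ) {f : ℕ → A}
    (hf : ∀ m < n, f m = 0 ∨ φ (f m) ≠ 0)
    (hcl : ∀ m < n, p ^ (m + 1) * f m ∈ tailIdeal p n f (m + 1))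
    {j : ℕ} (hj : j < n) {g : A} (hg : p ^ j * g ∈ tailIdeal p n f 0) :
    φ (f j) ∣ φ g := by
  have key : ∀ m ≤ j, p ^ j * g ∈ tailIdeal p n f m := by
    intro m
    induction m with
    | zero => exact fun _ => hg
    | succ m ih =>
      intro hm
      exact h.mem_tailIdeal_succ (by omega) (hf m (by omega)) (hcl m (by omega))
        (ih (by omega)) ((pow_dvd_pow p hm).mul_right g)
  obtain ⟨c, y, hy, hc⟩ := (mem_tailIdeal_iff hj).1 (key j le_rfl)
  obtain ⟨w, rfl⟩ := pow_dvd_of_mem_tailIdeal hy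
  have h1 : φ (g - c * f j) = 0 :=
    h.map_eq_zero_of_pow_mul_eq hj (w := w) (by linear_combination hc)
  rw [map_sub, map_mul, sub_eq_zero] at h1
  exact ⟨φ c, by rw [h1, mul_comm]⟩

end IsChainReduction

section NormalForm

variable {A K : Type*} [CommRing A] [Field K] {p : A} {n : ℕ} {φ : A →+* K[X]} {S : Set A}
  {J : Ideal A} {α : ℕ → K[X]} {a f : ℕ → A} {i : ℕ}

/-- Modulo `J`, every `p ^ m * u` with `p ^ (m + 1) * u ∈ J` is a sum of terms
`p ^ l * b l * f (l + 1)` with reduced coefficients `b l`. -/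
theorem IsChainReduction.exists_normalForm (h : IsChainReduction p n φ)
    (hS : ∀ r, ∃ b ∈ S, φ b = r)
    (hfJ : ∀ l, i ≤ l → l ≤ n → p ^ l * f l ∈ J) (hf : ∀ l, i ≤ l → l ≤ n → φ (f l) = α l)
    (ha : ∀ l, i ≤ l → l < n → φ (a l) * α (l + 1) = α l)
    (hα : ∀ l, i ≤ l → l ≤ n → α l ≠ 0)
    (hJ : ∀ j ≤ n, ∀ g, p ^ j * g ∈ J → α j ∣ φ g)
    (m : ℕ) (him : i ≤ m) (hmn : m ≤ n) (u : A) (hu : p ^ (m + 1) * u ∈ J) :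
    ∃ b : ℕ → A, (∀ l, m ≤ l → l < n →
        b l ∈ S ∧ (φ (b l)).degree + (α (l + 1)).degree < (α l).degree) ∧
      p ^ m * u - ∑ l ∈ Finset.Ico m n, p ^ l * b l * f (l + 1) ∈ J := by
  induction hmn using Nat.decreasingInduction generalizing u with
  | self => exact ⟨fun _ => 0, fun l _ _ => by omega, by simp [h.pow_eq_zero]⟩
  | of_succ m hmn ih =>
    obtain ⟨v, hv⟩ := hJ (m + 1) hmn u hu
    obtain ⟨q, -, hq⟩ := hS (v / φ (a m))
    obtain ⟨b₀, hb₀S, hb₀⟩ := hS (v % φ (a m))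
    have ham := ha m him hmn
    have ham0 : φ (a m) ≠ 0 := fun h0 => hα m him hmn.le (by rw [← ham, h0, zero_mul])
    have hα1 := hα (m + 1) (by omega) hmn
    have hw : φ (u - q * f m - b₀ * f (m + 1)) = 0 := by
      rw [map_sub, map_sub, map_mul, map_mul, hv, hq, hb₀, hf m him hmn.le,
        hf (m + 1) (by omega) hmn, ← ham]
      linear_combination (-α (m + 1)) * EuclideanDomain.div_add_mod v (φ (a m))
    obtain ⟨w, hw⟩ := (h.map_eq_zero_iff _).1 hw
    have hwJ : p ^ (m + 1 + 1) * w ∈ J := by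
      have : p ^ (m + 1 + 1) * w = p ^ (m + 1) * u - (p * q) * (p ^ m * f m)
          - b₀ * (p ^ (m + 1) * f (m + 1)) := by
        linear_combination (-p ^ (m + 1)) * hw
      rw [this]
      exact J.sub_mem (J.sub_mem hu (J.mul_mem_left _ (hfJ m him hmn.le)))
        (J.mul_mem_left _ (hfJ (m + 1) (by omega) hmn))
    obtain ⟨b, hb, hbJ⟩ := ih (by omega) w hwJ
    refine ⟨Function.update b m b₀, fun l hl hln => ?_, ?_⟩
    · rcases hl.eq_or_lt with rfl | hl
      · rw [Function.update_self]
        refine ⟨hb₀S, ?_⟩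
        rw [hb₀, ← ham, degree_mul]
        exact WithBot.add_lt_add_right (degree_ne_bot.2 hα1)
          (EuclideanDomain.mod_lt v ham0)
      · rw [Function.update_of_ne hl.ne']
        exact hb l hl hln
    · rw [Finset.sum_eq_sum_Ico_succ_bot hmn, Function.update_self,
        Finset.sum_congr rfl (g := fun l => p ^ l * b l * f (l + 1))]
      · have : p ^ m * u - (p ^ m * b₀ * f (m + 1)
            + ∑ l ∈ Finset.Ico (m + 1) n, p ^ l * b l * f (l + 1)) =
            (p ^ (m + 1) * w - ∑ l ∈ Finset.Ico (m + 1) n, p ^ l * b l * f (l + 1))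
              + q * (p ^ m * f m) := by
          linear_combination p ^ m * hw
        rw [this]
        exact J.add_mem hbJ (J.mul_mem_left _ (hfJ m him hmn.le))
      · intro l hl
        rw [Finset.mem_Ico] at hl
        rw [Function.update_of_ne (by omega)]

/-- Reduced coefficients of a normal form modulo `J` are unique. -/
theorem IsChainReduction.eq_of_sum_sub_sum_mem (h : IsChainReduction p n φ)
    (hS : Set.InjOn φ S) (hf : ∀ l ≤ n, i ≤ l → φ (f l) = α l)
    (hα : ∀ l ≤ n, i ≤ l → α l ≠ 0)
    (hJ : ∀ j < n, ∀ g, p ^ j * g ∈ J → α j ∣ φ g)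
    {b b' : ℕ → A} (m : ℕ) (him : i ≤ m)
    (hb : ∀ l, m ≤ l → l < n →
      b l ∈ S ∧ (φ (b l)).degree + (α (l + 1)).degree < (α l).degree)
    (hb' : ∀ l, m ≤ l → l < n →
      b' l ∈ S ∧ (φ (b' l)).degree + (α (l + 1)).degree < (α l).degree)
    (hmem : ∑ l ∈ Finset.Ico m n, p ^ l * b l * f (l + 1) -
      ∑ l ∈ Finset.Ico m n, p ^ l * b' l * f (l + 1) ∈ J) :
    ∀ l, m ≤ l → l < n → b l = b' l := by
  rcases le_or_gt n m with hnm | hmn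
  · exact fun l _ _ => by omega
  induction hmn.le using Nat.decreasingInduction with
  | self => exact fun l _ _ => by omega
  | of_succ m hmn' ih =>
    rw [Finset.sum_eq_sum_Ico_succ_bot hmn, Finset.sum_eq_sum_Ico_succ_bot hmn] at hmem
    have hdvd : ∀ d : ℕ → A,
        ∃ w, ∑ l ∈ Finset.Ico (m + 1) n, p ^ l * d l * f (l + 1) = p ^ (m + 1) * w :=
      fun d => Finset.dvd_sum fun l hl =>
        ((pow_dvd_pow p (Finset.mem_Ico.1 hl).1).mul_right _).mul_right _
    obtain ⟨w, hw⟩ := hdvd b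
    obtain ⟨w', hw'⟩ := hdvd b'
    have hα1 := hα (m + 1) hmn (by omega)
    have heq : b m = b' m := by
      refine hS (hb m le_rfl hmn).1 (hb' m le_rfl hmn).1 (sub_eq_zero.1 ?_)
      have h1 := hJ m hmn ((b m - b' m) * f (m + 1) + p * (w - w')) (by
        convert hmem using 1
        rw [hw, hw']
        ring)
      simp only [map_add, map_mul, h.map_self, zero_mul, add_zero, map_sub,
        hf (m + 1) hmn (by omega)] at h1
      have h2 := eq_zero_of_dvd_of_degree_lt h1 (by
        rw [sub_mul]
        refine (degree_sub_le _ _).trans_lt (max_lt ?_ ?_) <;> rw [degree_mul]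
        exacts [(hb m le_rfl hmn).2, (hb' m le_rfl hmn).2])
      exact (mul_eq_zero.1 h2).resolve_right hα1
    intro l hl hln
    rcases hl.eq_or_lt with rfl | hl
    · exact heq
    · refine ih (by omega) (fun l hl => hb l (by omega)) (fun l hl => hb' l (by omega)) ?_
        (by omega) l hl hln
      rw [heq] at hmem
      convert hmem using 1
      ring

theorem IsChainReduction.tailIdeal_eq (h : IsChainReduction p n φ)
    (hφ : Function.Surjective φ)
    (hfJ : ∀ l < n, p ^ l * f l ∈ J)
    (hJ : ∀ j < n, ∀ g, p ^ j * g ∈ J → φ (f j) ∣ φ g) : tailIdeal p n f 0 = J := by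
  have hle : tailIdeal p n f 0 ≤ J := Ideal.span_le.2 (by
    rintro _ ⟨j, hj, rfl⟩
    exact hfJ j hj.2)
  refine le_antisymm hle fun x hx => ?_
  have key : ∀ m ≤ n, ∀ g, p ^ m * g ∈ J → p ^ m * g ∈ tailIdeal p n f 0 := by
    intro m hm
    induction hm using Nat.decreasingInduction with
    | self => simp [h.pow_eq_zero]
    | of_succ m hmn ih =>
      intro g hg
      have hmem := pow_mul_mem_tailIdeal (f := f) h.pow_eq_zero (Nat.zero_le m) hmn.le
      obtain ⟨q, hq⟩ := hJ m hmn g hg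
      obtain ⟨c, rfl⟩ := hφ q
      obtain ⟨w, hw⟩ := (h.map_eq_zero_iff (g - f m * c)).1 (by rw [map_sub, map_mul, hq, sub_self])
      have hpw : p ^ (m + 1) * w = p ^ m * g - c * (p ^ m * f m) := by
        linear_combination (-p ^ m) * hw
      have hwJ := ih w (hpw ▸ J.sub_mem hg (J.mul_mem_left _ (hfJ m hmn)))
      have : p ^ m * g = p ^ (m + 1) * w + c * (p ^ m * f m) := by rw [hpw]; ring
      rw [this]
      exact Ideal.add_mem _ hwJ (Ideal.mul_mem_left _ _ hmem)
  simpa using key 0 (Nat.zero_le n) x (by simpa using hx)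

theorem IsChainReduction.map_build (h : IsChainReduction p n φ) {b : ℕ → ℕ → A}
    (hfn : f n = 1) (hαn : α n = 1)
    (ha : ∀ l, i ≤ l → l < n → φ (a l) * α (l + 1) = α l)
    (hf : ∀ j, i ≤ j → j < n → f j = a j * f (j + 1) +
      ∑ k ∈ Finset.Icc 1 (n - j - 1), p ^ k * b j k * f (j + k + 1))
    (l : ℕ) (hil : i ≤ l) (hln : l ≤ n) : φ (f l) = α l := by
  induction hln using Nat.decreasingInduction with
  | self => rw [hfn, hαn, map_one]
  | of_succ l hln ih =>
    rw [h.map_eq_of_eq_add_sum (fun k hk => (Finset.mem_Icc.1 hk).1) (hf l hil hln),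
      ih (by omega), ha l hil hln]

/-- Existence of data producing generators inside `J` of the prescribed shape. -/
theorem IsChainReduction.exists_build (h : IsChainReduction p n φ)
    (hS : ∀ r, ∃ b ∈ S, φ b = r)
    (hα : ∀ l, i ≤ l → l ≤ n → α l ≠ 0) (hαn : α n = 1)
    (ha : ∀ l, i ≤ l → l < n → φ (a l) * α (l + 1) = α l)
    (hJ : ∀ j ≤ n, ∀ g, p ^ j * g ∈ J → α j ∣ φ g)
    (hg : ∀ j, i ≤ j → j < n → ∃ g, p ^ j * g ∈ J ∧ φ g = α j) (hi : i ≤ n) :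
    ∃ (b : ℕ → ℕ → A) (f : ℕ → A), f n = 1 ∧ ∀ j, i ≤ j → j < n →
      p ^ j * f j ∈ J ∧
      (∀ k, 1 ≤ k → j + k < n → b j k ∈ S ∧
        (φ (b j k)).degree + (α (j + k + 1)).degree < (α (j + k)).degree) ∧
      f j = a j * f (j + 1) +
        ∑ k ∈ Finset.Icc 1 (n - j - 1), p ^ k * b j k * f (j + k + 1) := by
  induction hi using Nat.decreasingInduction with
  | self => exact ⟨fun _ _ => 0, fun _ => 1, rfl, fun j _ _ => by omega⟩
  | of_succ i hin ih =>
    obtain ⟨b, f, hfn, H⟩ := ih (fun l hl => hα l (by omega)) (fun l hl => ha l (by omega))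
      (fun l hl => hg l (by omega))
    have hfJ : ∀ l, i + 1 ≤ l → l ≤ n → p ^ l * f l ∈ J := by
      intro l hl hln
      rcases hln.eq_or_lt with rfl | hln
      · simp [h.pow_eq_zero]
      · exact (H l hl hln).1
    have hf : ∀ l, i + 1 ≤ l → l ≤ n → φ (f l) = α l := by
      exact h.map_build hfn hαn (fun l hl => ha l (by omega))
        fun l hl hln => (H l hl hln).2.2
    obtain ⟨g, hgJ, hg⟩ := hg i le_rfl hin
    have hw : φ (g - a i * f (i + 1)) = 0 := by
      rw [map_sub, map_mul, hf (i + 1) le_rfl hin, hg, ha i le_rfl hin, sub_self]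
    obtain ⟨w, hw⟩ := (h.map_eq_zero_iff _).1 hw
    have hfi := hfJ (i + 1) le_rfl hin
    obtain ⟨c, hc, hcJ⟩ := h.exists_normalForm hS hfJ hf (fun l hl => ha l (by omega))
      (fun l hl => hα l (by omega)) hJ (i + 1) le_rfl hin w (by
        have : p ^ (i + 1 + 1) * w = p * (p ^ i * g) - a i * (p ^ (i + 1) * f (i + 1)) := by
          linear_combination (-p ^ (i + 1)) * hw
        rw [this]
        exact J.sub_mem (J.mul_mem_left _ hgJ) (J.mul_mem_left _ hfi))
    set s := a i * f (i + 1) +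
        ∑ k ∈ Finset.Icc 1 (n - i - 1), p ^ k * c (i + k) * f (i + k + 1) with hs
    refine ⟨Function.update b i fun k => c (i + k), Function.update f i s, ?_, ?_⟩
    · rw [Function.update_of_ne hin.ne', hfn]
    · intro j hij hjn
      have hupd : ∀ k, Function.update f i s (j + k + 1) = f (j + k + 1) :=
        fun k => Function.update_of_ne (by omega) _ _
      simp only [hupd, Function.update_of_ne (show j + 1 ≠ i by omega)]
      rcases hij.eq_or_lt with rfl | hij
      · simp only [Function.update_self]
        refine ⟨?_, fun k hk hkn => hc (i + k) (by omega) hkn, hs⟩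
        have : p ^ i * s = p ^ i * g -
            (p ^ (i + 1) * w - ∑ l ∈ Finset.Ico (i + 1) n, p ^ l * c l * f (l + 1)) := by
          rw [← pow_mul_sum_Icc, hs]
          linear_combination (-p ^ i) * hw
        rw [this]
        exact J.sub_mem hgJ hcJ
      · simp only [Function.update_of_ne hij.ne']
        exact H j hij hjn

/-- The coefficients of the recursive construction are determined by the resulting ideal. -/
theorem IsChainReduction.coeff_eq_of_build (h : IsChainReduction p n φ)
    (hS : Set.InjOn φ S) (hα : ∀ l, i ≤ l → l ≤ n → α l ≠ 0)
    (hJ : ∀ j < n, ∀ g, p ^ j * g ∈ J → α j ∣ φ g)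
    {b b' : ℕ → ℕ → A} {f' : ℕ → A}
    (hb : ∀ j k, i ≤ j → 1 ≤ k → j + k < n → b j k ∈ S ∧
      (φ (b j k)).degree + (α (j + k + 1)).degree < (α (j + k)).degree)
    (hb' : ∀ j k, i ≤ j → 1 ≤ k → j + k < n → b' j k ∈ S ∧
      (φ (b' j k)).degree + (α (j + k + 1)).degree < (α (j + k)).degree)
    (hf : ∀ j, i ≤ j → j < n → f j = a j * f (j + 1) +
      ∑ k ∈ Finset.Icc 1 (n - j - 1), p ^ k * b j k * f (j + k + 1))
    (hf' : ∀ j, i ≤ j → j < n → f' j = a j * f' (j + 1) +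
      ∑ k ∈ Finset.Icc 1 (n - j - 1), p ^ k * b' j k * f' (j + k + 1))
    (hfn : f n = f' n) (hfα : ∀ l, i ≤ l → l ≤ n → φ (f l) = α l)
    (hfJ : ∀ l < n, p ^ l * f l ∈ J) (hfJ' : ∀ l < n, p ^ l * f' l ∈ J) :
    ∀ j k, i ≤ j → 1 ≤ k → j + k < n → b j k = b' j k := by
  have step : ∀ j, i ≤ j → j < n → (∀ l, j < l → l ≤ n → f l = f' l) →
      ∀ k, 1 ≤ k → j + k < n → b j k = b' j k := by
    intro j hij hjn hl k hk hkn
    have hsum : ∑ k ∈ Finset.Icc 1 (n - j - 1), p ^ k * b' j k * f' (j + k + 1) =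
        ∑ k ∈ Finset.Icc 1 (n - j - 1), p ^ k * b' j k * f (j + k + 1) :=
      Finset.sum_congr rfl fun k hk => by
        rw [Finset.mem_Icc] at hk
        rw [hl (j + k + 1) (by omega) (by omega)]
    have hmem := J.sub_mem (hfJ j hjn) (hfJ' j hjn)
    rw [hf j hij hjn, hf' j hij hjn, hsum, ← hl (j + 1) (by omega) hjn, mul_add, mul_add,
      add_sub_add_left_eq_sub] at hmem
    have e := pow_mul_sum_Icc (p := p) (n := n) (f := f) j fun l => b j (l - j)
    have e' := pow_mul_sum_Icc (p := p) (n := n) (f := f) j fun l => b' j (l - j)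
    simp only [add_tsub_cancel_left] at e e'
    rw [e, e'] at hmem
    have hmain := h.eq_of_sum_sub_sum_mem hS (fun l h1 h2 => hfα l h2 h1)
      (fun l h1 h2 => hα l h2 h1) hJ (j + 1) (by omega) (fun l hl hln => ?_)
      (fun l hl hln => ?_) hmem (j + k) (by omega) hkn
    · simpa only [add_tsub_cancel_left] using hmain
    · simpa only [Nat.add_sub_cancel' (show j ≤ l by omega)] using
        hb j (l - j) hij (by omega) (by omega)
    · simpa only [Nat.add_sub_cancel' (show j ≤ l by omega)] using
        hb' j (l - j) hij (by omega) (by omega)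
  have hff : ∀ j, i ≤ j → j ≤ n → ∀ l, j ≤ l → l ≤ n → f l = f' l := by
    intro j hij hjn
    induction hjn using Nat.decreasingInduction with
    | self =>
      intro l hl hln
      rw [hln.antisymm hl, hfn]
    | of_succ j hjn ih =>
      have ih := ih (by omega)
      intro l hl hln
      rcases hl.eq_or_lt with rfl | hl
      · rw [hf j hij hjn, hf' j hij hjn, ih (j + 1) le_rfl hjn]
        congr 1
        refine Finset.sum_congr rfl fun k hk => ?_
        rw [Finset.mem_Icc] at hk
        rw [step j hij hjn ih k hk.1 (by omega), ih (j + k + 1) (by omega) (by omega)]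
      · exact ih l hl hln
  exact fun j k hij hk hkn => step j hij (by omega)
    (fun l hl hln => hff j hij (by omega) l hl.le hln) k hk hkn

end NormalForm

section Reduction

variable {R : Type*} [CommRing R] {π : R} {n : ℕ} {𝔉 : Set R}

theorem redMod_eq_zero_iff (g : R[X]) : redMod π g = 0 ↔ C π ∣ g := by
  rw [← RingHom.mem_ker, redMod, Polynomial.ker_mapRingHom, Ideal.mk_ker, Ideal.map_span,
    Set.image_singleton, Ideal.mem_span_singleton]

theorem isChainReduction_redMod [IsLocalRing R]
    (hmax : IsLocalRing.maximalIdeal R = Ideal.span {π})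
    (hnil : π ^ n = 0) (hne : π ^ (n - 1) ≠ 0) :
    IsChainReduction (C π) n (redMod π) where
  map_eq_zero_iff := redMod_eq_zero_iff
  pow_eq_zero := by rw [← C_pow, hnil, C_0]
  map_eq_zero_of_pow_mul_eq_zero m hm g hg := by
    ext k
    rw [redMod, coe_mapRingHom, coeff_map, coeff_zero, Ideal.Quotient.eq_zero_iff_mem, ← hmax,
      IsLocalRing.mem_maximalIdeal, mem_nonunits_iff]
    intro hu
    have hk := congrArg (fun q => coeff q k) hg
    simp only [← C_pow, coeff_C_mul, coeff_zero] at hk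
    rw [hu.mul_left_eq_zero] at hk
    exact hne (by rw [← Nat.add_sub_of_le (show m ≤ n - 1 by omega), pow_add, hk, zero_mul])

theorem exists_coeffsIn_redMod_eq (h𝔉0 : (0 : R) ∈ 𝔉)
    (h𝔉 : ∀ x : R, ∃! c : R, c ∈ 𝔉 ∧ x - c ∈ Ideal.span {π})
    (r : (R ⧸ Ideal.span {π})[X]) : ∃ b ∈ {b | CoeffsIn 𝔉 b}, redMod π b = r := by
  have hσ : ∀ y : R ⧸ Ideal.span {π}, ∃ c ∈ 𝔉, Ideal.Quotient.mk (Ideal.span {π}) c = y := by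
    intro y
    obtain ⟨x, rfl⟩ := Ideal.Quotient.mk_surjective y
    obtain ⟨c, ⟨hc, hxc⟩, -⟩ := h𝔉 x
    exact ⟨c, hc, (Ideal.Quotient.eq.2 hxc).symm⟩
  choose σ hσ𝔉 hσ using hσ
  have hcoeff : ∀ m, (∑ l ∈ Finset.range (r.natDegree + 1), C (σ (r.coeff l)) * X ^ l).coeff m =
      if m ≤ r.natDegree then σ (r.coeff m) else 0 := by
    intro m
    simp [coeff_X_pow]
  refine ⟨∑ l ∈ Finset.range (r.natDegree + 1), C (σ (r.coeff l)) * X ^ l, fun m => ?_, ?_⟩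
  · rw [hcoeff]
    split_ifs
    exacts [hσ𝔉 _, h𝔉0]
  · ext m
    rw [redMod, coe_mapRingHom, coeff_map, hcoeff]
    split_ifs with hm
    · exact hσ _
    · rw [map_zero, coeff_eq_zero_of_natDegree_lt (not_le.1 hm)]

theorem injOn_coeffsIn_redMod
    (h𝔉 : ∀ x : R, ∃! c : R, c ∈ 𝔉 ∧ x - c ∈ Ideal.span {π}) :
    Set.InjOn (redMod π) {b | CoeffsIn 𝔉 b} := by
  intro b hb b' hb' hbb
  ext m
  have hm := congrArg (fun q => coeff q m) hbb
  simp only [redMod, coe_mapRingHom, coeff_map] at hm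
  exact (h𝔉 (b.coeff m)).unique ⟨hb m, by simp⟩ ⟨hb' m, Ideal.Quotient.eq.1 hm⟩

theorem degree_redMod_of_coeffsIn (h𝔉0 : (0 : R) ∈ 𝔉)
    (h𝔉 : ∀ x : R, ∃! c : R, c ∈ 𝔉 ∧ x - c ∈ Ideal.span {π})
    {b : R[X]} (hb : CoeffsIn 𝔉 b) : (redMod π b).degree = b.degree := by
  by_cases hb0 : b = 0
  · simp [hb0]
  · refine degree_map_eq_of_leadingCoeff_ne_zero _ fun h0 => hb0 (leadingCoeff_eq_zero.1 ?_)
    rw [Ideal.Quotient.eq_zero_iff_mem] at h0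
    exact (h𝔉 b.leadingCoeff).unique ⟨hb _, by simp⟩ ⟨h𝔉0, by simpa using h0⟩

end Reduction

/-- Proposition 5.1: the map `(b_{jk}) ↦ ⟨π^0 f_0, …, π^{n-1} f_{n-1}⟩` is a bijection from
`𝓑` onto the set of ideals of `R[x]` whose invariant sequence is `(α_0, …, α_{n-1})`
up to associates. -/
theorem ideals_with_given_invariant_sequence_param {R : Type*} [CommRing R] [IsLocalRing R]
    (π : R) (n : ℕ) (hn : 1 ≤ n)
    (hmax : IsLocalRing.maximalIdeal R = Ideal.span {π})
    (hnil : π ^ n = 0) (hne : π ^ (n - 1) ≠ 0)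
    (𝔉 : Set R) (h𝔉0 : (0 : R) ∈ 𝔉)
    (h𝔉 : ∀ x : R, ∃! c : R, c ∈ 𝔉 ∧ x - c ∈ Ideal.span {π})
    (α : ℕ → (R ⧸ Ideal.span {π})[X])
    (hchain : ∀ j : ℕ, j + 1 < n → α (j + 1) ∣ α j) (hαn : α n = 1)
    (i : ℕ) (hi : i < n) (hzero : ∀ j < i, α j = 0) (hαi : α i ≠ 0)
    (a : ℕ → R[X])
    (ha : ∀ j : ℕ, i ≤ j → j < n →
      CoeffsIn 𝔉 (a j) ∧ redMod π (a j) * α (j + 1) = α j) :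
    (∀ J : Ideal R[X],
      (∃ (b : ℕ → ℕ → R[X]) (f : ℕ → R[X]), MemB π 𝔉 n i α b ∧ BuildEq π n i a b f ∧
          J = Ideal.span ((fun j => C π ^ j * f j) '' Set.Ico 0 n)) ↔
        (∃ g : ℕ → R[X], IsCanonicalSequence π n J g ∧
          ∀ j < n, Associated (redMod π (g j)) (α j))) ∧
    (∀ (b b' : ℕ → ℕ → R[X]) (f f' : ℕ → R[X]),
      MemB π 𝔉 n i α b → BuildEq π n i a b f →
      MemB π 𝔉 n i α b' → BuildEq π n i a b' f' →
      Ideal.span ((fun j => C π ^ j * f j) '' Set.Ico 0 n) =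
        Ideal.span ((fun j => C π ^ j * f' j) '' Set.Ico 0 n) →
      ∀ j k : ℕ, i ≤ j → j + 2 ≤ n → 1 ≤ k → k + j + 1 ≤ n → b j k = b' j k) := by
  have : (Ideal.span {π}).IsMaximal := hmax ▸ inferInstance
  let _ : Field (R ⧸ Ideal.span {π}) := Ideal.Quotient.field _
  have h := isChainReduction_redMod hmax hnil hne
  have hS := exists_coeffsIn_redMod_eq h𝔉0 h𝔉
  have hinj := injOn_coeffsIn_redMod h𝔉
  have hφ : Function.Surjective (redMod π) := fun r => (hS r).imp fun _ hb => hb.2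
  have hmul : ∀ l, i ≤ l → l < n → redMod π (a l) * α (l + 1) = α l :=
    fun l hl hln => (ha l hl hln).2
  have hα : ∀ l, i ≤ l → l ≤ n → α l ≠ 0 := by
    intro l hl
    induction l, hl using Nat.le_induction with
    | base => exact fun _ => hαi
    | succ l hl ih =>
      intro hln h0
      exact ih (by omega) (by rw [← hmul l hl hln, h0, mul_zero])
  have hB : ∀ b : ℕ → ℕ → R[X], MemB π 𝔉 n i α b → ∀ j k, i ≤ j → 1 ≤ k → j + k < n →
      b j k ∈ {b | CoeffsIn 𝔉 b} ∧
        (redMod π (b j k)).degree + (α (j + k + 1)).degree < (α (j + k)).degree := by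
    intro b hb j k hij hk hkn
    obtain ⟨hb𝔉, hdeg⟩ := hb j k hij (by omega) hk (by omega)
    refine ⟨hb𝔉, ?_⟩
    rw [degree_redMod_of_coeffsIn h𝔉0 h𝔉 hb𝔉]
    rcases hdeg with h0 | hdeg
    · rw [h0, degree_zero, WithBot.bot_add, bot_lt_iff_ne_bot, degree_ne_bot]
      exact hα (j + k) (by omega) hkn.le
    · exact hdeg
  have hfα : ∀ b f : _, BuildEq π n i a b f → ∀ l ≤ n, redMod π (f l) = α l := by
    rintro b f ⟨hfn, hf0, hf⟩ l hln
    rcases lt_or_ge l i with hl | hl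
    · rw [hf0 l hl, hzero l hl, map_zero]
    · exact h.map_build hfn hαn hmul hf l hl hln
  have hdvd : ∀ b f : _, BuildEq π n i a b f →
      ∀ j < n, ∀ g, C π ^ j * g ∈ tailIdeal (C π) n f 0 → α j ∣ redMod π g := by
    intro b f hbf j hj g hg
    rw [← hfα b f hbf j hj.le]
    refine h.dvd_map_of_pow_mul_mem (fun m hm => ?_) (fun m hm => ?_) hj hg
    all_goals rcases lt_or_ge m i with hmi | hmi
    · exact Or.inl (hbf.2.1 m hmi)
    · exact Or.inr (hfα b f hbf m hm.le ▸ hα m hmi hm.le)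
    · simp [hbf.2.1 m hmi]
    · exact pow_succ_mul_mem_tailIdeal h.pow_eq_zero hm (hbf.2.2 m hmi hm)
  refine ⟨fun J => ⟨?_, ?_⟩, ?_⟩
  · rintro ⟨b, f, -, hbf, rfl⟩
    refine ⟨f, fun j hj => ⟨pow_mul_mem_tailIdeal h.pow_eq_zero j.zero_le hj.le, fun g hg => ?_⟩,
      fun j hj => by rw [hfα b f hbf j hj.le]⟩
    rw [hfα b f hbf j hj.le, or_iff_not_imp_left]
    intro hg0
    have := hdvd b f hbf j hj g hg
    exact ⟨ne_zero_of_dvd_ne_zero hg0 this, degree_le_of_dvd this hg0⟩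
  · rintro ⟨g, hg, hgα⟩
    have hJ : ∀ j ≤ n, ∀ u, C π ^ j * u ∈ J → α j ∣ redMod π u := by
      intro j hj u hu
      rcases hj.eq_or_lt with rfl | hj
      · rw [hαn]
        exact one_dvd _
      rw [← (hgα j hj).dvd_iff_dvd_left]
      obtain ⟨hgJ, hmin⟩ := hg j hj
      rcases hmin u hu with h0 | ⟨hg0, -⟩
      · rw [h0]
        exact dvd_zero _
      obtain ⟨q, hq⟩ := hφ (redMod π u / redMod π (g j))
      have hmod : redMod π (u - q * g j) = redMod π u % redMod π (g j) := by
        rw [map_sub, map_mul, hq, EuclideanDomain.mod_eq_sub_mul_div, mul_comm]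
      have hmem : C π ^ j * (u - q * g j) ∈ J := by
        rw [mul_sub, mul_left_comm]
        exact J.sub_mem hu (J.mul_mem_left _ hgJ)
      rw [← EuclideanDomain.mod_eq_zero, ← hmod]
      refine (hmin _ hmem).resolve_right fun hle => hle.2.not_gt ?_
      rw [hmod]
      exact EuclideanDomain.mod_lt _ hg0
    have hgen : ∀ j, i ≤ j → j < n → ∃ g, C π ^ j * g ∈ J ∧ redMod π g = α j := by
      intro j _ hj
      obtain ⟨u, hu⟩ := hgα j hj
      obtain ⟨c, hc⟩ := hφ u
      refine ⟨g j * c, ?_, by rw [map_mul, hc, hu]⟩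
      rw [← mul_assoc]
      exact J.mul_mem_right _ (hg j hj).1
    obtain ⟨b, f, hfn, H⟩ := h.exists_build hS hα hαn hmul hJ hgen hi.le
    have hbf : BuildEq π n i a b fun j => if j < i then 0 else f j := by
      refine ⟨by simp [hi.not_gt, hfn], fun j hj => by simp [hj], fun j hij hjn => ?_⟩
      have hlt : ∀ k, ¬ j + k < i := fun k => by omega
      simpa only [add_assoc, hlt, hij.not_gt, if_false] using (H j hij hjn).2.2
    refine ⟨b, _, fun j k hij _ hk hkn => ?_, hbf, (h.tailIdeal_eq hφ (fun l hl => ?_)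
      fun j hj u hu => ?_).symm⟩
    · obtain ⟨hb, hdeg⟩ := (H j hij (by omega)).2.1 k hk (by omega)
      rw [degree_redMod_of_coeffsIn h𝔉0 h𝔉 hb] at hdeg
      exact ⟨hb, Or.inr hdeg⟩
    · split_ifs with hli
      · simp
      · exact (H l (not_lt.1 hli) hl).1
    · rw [hfα b _ hbf j hj.le]
      exact hJ j hj.le u hu
  · intro b b' f f' hb hbf hb' hbf' hff j k hij _ hk hkn
    refine h.coeff_eq_of_build hinj hα (hdvd b f hbf) (hB b hb) (hB b' hb') hbf.2.2 hbf'.2.2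
      (hbf.1.trans hbf'.1.symm) (fun l _ => hfα b f hbf l)
      (fun l hl => pow_mul_mem_tailIdeal h.pow_eq_zero l.zero_le hl.le) (fun l hl => ?_)
      j k hij hk (by omega)
    change _ ∈ Ideal.span _
    rw [hff]
    exact pow_mul_mem_tailIdeal h.pow_eq_zero l.zero_le hl.le
end
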